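/- Let ξ ∈ (0,1). The three functions La_ξ, Lb_ξ, Lc_ξ : ℝ → ℝ are linearly independent over ℝ: if a, b, c ∈ ℝ satisfy a·La_ξ(θ) + b·Lb_ξ(θ) + c·Lc_ξ(θ) = 0 for all θ ∈ ℝ, then a = b = c = 0. -/

import Mathlib

open Real Filter

section CubicLaplace

open MeasureTheory Topology

lemma tendsto_integral_exp_mul_comp_exp {s T : ℝ} (hs : -1 < s) (hT : 0 < T) {h : ℝ → ℂ}
    (hh : Continuous h) :
    Tendsto (fun x₀ : ℝ => ∫ x in x₀..log T, ((rexp ((s + 1) * x) : ℝ) : ℂ) * h (rexp x)) atBot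
      (𝓝 (∫ τ in (0 : ℝ)..T, ((τ ^ s : ℝ) : ℂ) * h τ)) := by
  have hint : IntervalIntegrable (fun τ : ℝ => ((τ ^ s : ℝ) : ℂ) * h τ) volume 0 T :=
    IntervalIntegrable.mul_continuousOn
      ⟨(intervalIntegral.intervalIntegrable_rpow' hs).1.ofReal,
        (intervalIntegral.intervalIntegrable_rpow' hs).2.ofReal⟩ hh.continuousOn
  have hcont := intervalIntegral.continuousOn_primitive_interval_left
    ((intervalIntegrable_iff_integrableOn_Icc_of_le hT.le).1 hint |>.mono_set
      (Set.uIcc_of_le hT.le).le)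
  have h0 : Tendsto rexp atBot (𝓝[Set.uIcc 0 T] 0) := by
    refine tendsto_nhdsWithin_iff.2 ⟨tendsto_exp_atBot, ?_⟩
    filter_upwards [eventually_le_atBot (log T)] with x hx
    rw [Set.uIcc_of_le hT.le]
    exact ⟨(exp_pos x).le, (le_log_iff_exp_le hT).1 hx⟩
  refine ((hcont 0 Set.left_mem_uIcc).tendsto.comp h0).congr fun x₀ => ?_
  have key := intervalIntegral.integral_deriv_smul_comp' (a := x₀) (b := log T) (f := rexp)
    (f' := rexp) (g := fun τ : ℝ => ((τ ^ s : ℝ) : ℂ) * h τ)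
    (fun x _ => hasDerivAt_exp x) continuous_exp.continuousOn (by
      refine ContinuousOn.mul ?_ hh.continuousOn
      refine Complex.continuous_ofReal.comp_continuousOn ?_
      rintro _ ⟨x, -, rfl⟩
      exact (continuousAt_rpow_const _ _ (Or.inl (exp_pos x).ne')).continuousWithinAt)
  rw [exp_log hT] at key
  simp only [Function.comp]
  rw [← key]
  refine intervalIntegral.integral_congr fun x _ => ?_
  simp only [Function.comp, Complex.real_smul]
  rw [← mul_assoc, ← Complex.ofReal_mul]
  congr 2
  rw [← exp_mul, ← exp_add]
  ring_nf

lemma integral_rpow_mul_rotate {s T : ℝ} (hs : -1 < s) (hT : 0 < T) {g : ℂ → ℂ}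
    (hg : Differentiable ℂ g) (α : ℝ) :
    (∫ τ in (0 : ℝ)..T, ((τ ^ s : ℝ) : ℂ) * g τ)
      - Complex.exp ((s + 1) * (α * Complex.I))
        * (∫ τ in (0 : ℝ)..T, ((τ ^ s : ℝ) : ℂ) * g (τ * Complex.exp (α * Complex.I)))
      + Complex.I * (∫ y in (0 : ℝ)..α, ((T ^ (s + 1) : ℝ) : ℂ)
          * (Complex.exp ((s + 1) * (y * Complex.I)) * g (T * Complex.exp (y * Complex.I)))) = 0 := by
  set f : ℂ → ℂ := fun w => Complex.exp ((s + 1) * w) * g (Complex.exp w) with hf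
  have hfd : Differentiable ℂ f := by fun_prop
  have hfs : ∀ x y : ℝ, f (x + y * Complex.I) = ((rexp ((s + 1) * x) : ℝ) : ℂ) *
      (Complex.exp ((s + 1) * (y * Complex.I)) * g (rexp x * Complex.exp (y * Complex.I))) := by
    intro x y
    simp only [hf]
    push_cast
    rw [mul_add, Complex.exp_add, Complex.exp_add, mul_assoc]
  have hrect : ∀ x₀ : ℝ,
      (∫ x in x₀..log T, ((rexp ((s + 1) * x) : ℝ) : ℂ) * g (rexp x))
      - Complex.exp ((s + 1) * (α * Complex.I)) * (∫ x in x₀..log T,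
          ((rexp ((s + 1) * x) : ℝ) : ℂ) * g (rexp x * Complex.exp (α * Complex.I)))
      + Complex.I * (∫ y in (0 : ℝ)..α, ((T ^ (s + 1) : ℝ) : ℂ)
          * (Complex.exp ((s + 1) * (y * Complex.I)) * g (T * Complex.exp (y * Complex.I))))
      - Complex.I * (∫ y in (0 : ℝ)..α, f (x₀ + y * Complex.I)) = 0 := by
    intro x₀
    have := Complex.integral_boundary_rect_eq_zero_of_differentiableOn f (x₀ : ℂ)
      ((log T : ℝ) + α * Complex.I) hfd.differentiableOn
    rw [← this]
    simp only [Complex.ofReal_re, Complex.ofReal_im, Complex.add_re, Complex.mul_re, Complex.I_re,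
      Complex.I_im, Complex.add_im, Complex.mul_im, mul_zero, mul_one, sub_zero, add_zero,
      zero_add, smul_eq_mul]
    congr 1
    congr 1
    · congr 1
      · refine intervalIntegral.integral_congr fun x _ => ?_
        simp only [hfs]
        simp
      · rw [← intervalIntegral.integral_const_mul]
        refine intervalIntegral.integral_congr fun x _ => ?_
        simp only [hfs]
        ring
    · congr 1
      refine intervalIntegral.integral_congr fun y _ => ?_
      simp only [hfs, exp_log hT]
      rw [rpow_def_of_pos hT, mul_comm (log T)]
  have hleft : Tendsto (fun x₀ : ℝ => ∫ y in (0 : ℝ)..α, f (x₀ + y * Complex.I)) atBot (𝓝 0) := by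
    obtain ⟨C, hC⟩ := (isCompact_closedBall (0 : ℂ) 1).exists_bound_of_continuousOn
      hg.continuous.continuousOn
    have hlim : Tendsto (fun x₀ : ℝ => rexp ((s + 1) * x₀) * C * |α - 0|) atBot (𝓝 0) := by
      have h1 : Tendsto (fun x₀ : ℝ => rexp ((s + 1) * x₀)) atBot (𝓝 0) :=
        tendsto_exp_atBot.comp (tendsto_id.const_mul_atBot (by linarith))
      simpa using (h1.mul_const C).mul_const (|α - 0|)
    refine squeeze_zero_norm' ?_ hlim
    filter_upwards [eventually_le_atBot (0 : ℝ)] with x₀ hx₀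
    refine intervalIntegral.norm_integral_le_of_norm_le_const fun y _ => ?_
    have h1 : ‖Complex.exp ((s + 1) * (y * Complex.I))‖ = 1 := by
      have := Complex.norm_exp_ofReal_mul_I ((s + 1) * y)
      push_cast at this
      rwa [mul_assoc] at this
    rw [hfs, norm_mul, norm_mul, h1, one_mul, Complex.norm_real, norm_of_nonneg (exp_pos _).le]
    refine mul_le_mul_of_nonneg_left (hC _ ?_) (exp_pos _).le
    simpa using hx₀
  have hlim := (((tendsto_integral_exp_mul_comp_exp hs hT (h := fun τ : ℝ => g τ)
    (hg.continuous.comp (by fun_prop))).sub ((tendsto_integral_exp_mul_comp_exp hs hT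
      (h := fun τ : ℝ => g (τ * Complex.exp (α * Complex.I))) (hg.continuous.comp (by fun_prop))).const_mul
        (Complex.exp ((s + 1) * (α * Complex.I))))).add_const
      (Complex.I * (∫ y in (0 : ℝ)..α, ((T ^ (s + 1) : ℝ) : ℂ)
          * (Complex.exp ((s + 1) * (y * Complex.I)) * g (T * Complex.exp (y * Complex.I)))))).sub
      (hleft.const_mul Complex.I)
  simp only [hrect, mul_zero, sub_zero] at hlim
  exact tendsto_nhds_unique hlim tendsto_const_nhds

lemma exp_cubic_le {m τ : ℝ} (hm : 0 ≤ m) (hτ : 0 ≤ τ) :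
    rexp (-τ ^ 3 / 3 + m * τ) ≤ rexp ((m + 1) * (3 * (m + 1) + 1)) * rexp (-τ) := by
  rw [← exp_add, exp_le_exp]
  rcases le_total τ (3 * (m + 1) + 1) with h | h
  · have : 0 ≤ τ ^ 3 := by positivity
    nlinarith [mul_le_mul_of_nonneg_left h (by linarith : 0 ≤ m + 1)]
  · have h1 : 3 * (m + 1) ≤ τ ^ 2 := by nlinarith
    have : 0 ≤ (m + 1) * (3 * (m + 1) + 1) := by positivity
    nlinarith [mul_le_mul_of_nonneg_right h1 hτ]

lemma integrableOn_rpow_mul_exp_neg {s : ℝ} (hs : -1 < s) (C : ℝ) :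
    IntegrableOn (fun τ : ℝ => τ ^ s * (C * rexp (-τ))) (Set.Ioi 0) := by
  have := (integrableOn_rpow_mul_exp_neg_mul_rpow hs one_pos one_pos).const_mul C
  refine Integrable.congr this (Eventually.of_forall fun τ => ?_)
  simp only [rpow_one, neg_mul, one_mul]
  ring

/-- The moment `∫₀^∞ τ ^ s * exp (-τ ^ 3 / 3 + z τ) dτ` as a function of the complex variable `z`. -/
noncomputable def cubicLaplace (s : ℝ) (z : ℂ) : ℂ :=
  ∫ τ in Set.Ioi (0 : ℝ), ((τ ^ s : ℝ) : ℂ) * Complex.exp (-(τ : ℂ) ^ 3 / 3 + z * τ)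

lemma norm_cubicLaplace_integrand_le {s m τ : ℝ} {z : ℂ} (hz : ‖z‖ ≤ m) (hτ : 0 < τ) :
    ‖((τ ^ s : ℝ) : ℂ) * Complex.exp (-(τ : ℂ) ^ 3 / 3 + z * τ)‖
      ≤ τ ^ s * (rexp ((m + 1) * (3 * (m + 1) + 1)) * rexp (-τ)) := by
  have hre : (-(τ : ℂ) ^ 3 / 3 + z * τ).re = -τ ^ 3 / 3 + z.re * τ := by
    have : (-(τ : ℂ) ^ 3 / 3 + z * τ) = ((-τ ^ 3 / 3 : ℝ) : ℂ) + z * τ := by push_cast; ring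
    rw [this, Complex.add_re, Complex.ofReal_re, Complex.re_mul_ofReal]
  rw [norm_mul, Complex.norm_real, norm_of_nonneg (rpow_nonneg hτ.le _), Complex.norm_exp, hre]
  refine mul_le_mul_of_nonneg_left ?_ (rpow_nonneg hτ.le _)
  refine le_trans ?_ (exp_cubic_le ((norm_nonneg z).trans hz) hτ.le)
  rw [exp_le_exp]
  nlinarith [(Complex.re_le_norm z).trans hz]

lemma aestronglyMeasurable_cubicLaplace_integrand (s : ℝ) (z : ℂ) :
    AEStronglyMeasurable
      (fun τ : ℝ => ((τ ^ s : ℝ) : ℂ) * Complex.exp (-(τ : ℂ) ^ 3 / 3 + z * τ))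
      (volume.restrict (Set.Ioi 0)) := by
  refine Measurable.aestronglyMeasurable ?_
  fun_prop

lemma integrableOn_cubicLaplace {s : ℝ} (hs : -1 < s) (z : ℂ) :
    IntegrableOn (fun τ : ℝ => ((τ ^ s : ℝ) : ℂ) * Complex.exp (-(τ : ℂ) ^ 3 / 3 + z * τ))
      (Set.Ioi 0) := by
  refine (integrableOn_rpow_mul_exp_neg hs
    (rexp ((‖z‖ + 1) * (3 * (‖z‖ + 1) + 1)))).mono'
    (aestronglyMeasurable_cubicLaplace_integrand s z) ?_
  filter_upwards [ae_restrict_mem measurableSet_Ioi] with τ hτ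
  exact norm_cubicLaplace_integrand_le le_rfl hτ

lemma hasDerivAt_cubicLaplace {s : ℝ} (hs : -1 < s) (z : ℂ) :
    HasDerivAt (cubicLaplace s) (cubicLaplace (s + 1) z) z := by
  refine (hasDerivAt_integral_of_dominated_loc_of_deriv_le (Metric.ball_mem_nhds z one_pos)
    (Eventually.of_forall fun w => aestronglyMeasurable_cubicLaplace_integrand s w)
    (integrableOn_cubicLaplace hs z)
    (F' := fun w τ => (((τ : ℝ) ^ (s + 1) : ℝ) : ℂ) * Complex.exp (-(τ : ℂ) ^ 3 / 3 + w * τ))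
    (aestronglyMeasurable_cubicLaplace_integrand (s + 1) z) ?_
    (integrableOn_rpow_mul_exp_neg (by linarith : -1 < s + 1)
      (rexp ((‖z‖ + 1 + 1) * (3 * (‖z‖ + 1 + 1) + 1)))) ?_).2
  · filter_upwards [ae_restrict_mem measurableSet_Ioi] with τ hτ w hw
    refine norm_cubicLaplace_integrand_le ?_ hτ
    have := norm_sub_norm_le w z
    have h2 := mem_ball_iff_norm.1 hw
    linarith
  · filter_upwards [ae_restrict_mem measurableSet_Ioi] with τ hτ w _
    have h1 : HasDerivAt (fun w : ℂ => -(τ : ℂ) ^ 3 / 3 + w * τ) (τ : ℂ) w := by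
      simpa using ((hasDerivAt_id w).mul_const (τ : ℂ)).const_add (-(τ : ℂ) ^ 3 / 3)
    have h2 := h1.cexp.const_mul (((τ ^ s : ℝ) : ℂ))
    refine h2.congr_deriv ?_
    rw [rpow_add_one (Set.mem_Ioi.1 hτ).ne']
    push_cast
    ring

lemma cubicLaplace_ofReal (s x : ℝ) :
    cubicLaplace s x = ((∫ τ in Set.Ioi (0 : ℝ), rexp (-τ ^ 3 / 3 + x * τ) * τ ^ s : ℝ) : ℂ) := by
  rw [← integral_complex_ofReal, cubicLaplace]
  refine integral_congr_ae (Eventually.of_forall fun τ => ?_)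
  push_cast
  ring

lemma exists_cubicLaplace_zero_eq {s : ℝ} (hs : -1 < s) :
    ∃ r : ℝ, 0 < r ∧ cubicLaplace s 0 = r := by
  have hint : IntegrableOn (fun τ : ℝ => rexp (-τ ^ 3 / 3 + 0 * τ) * τ ^ s) (Set.Ioi 0) := by
    refine (integrableOn_cubicLaplace hs 0).re.congr ?_
    filter_upwards with τ
    have : ((τ ^ s : ℝ) : ℂ) * Complex.exp (-(τ : ℂ) ^ 3 / 3 + 0 * τ)
      = ((rexp (-τ ^ 3 / 3 + 0 * τ) * τ ^ s : ℝ) : ℂ) := by push_cast; ring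
    rw [this]
    exact Complex.ofReal_re _
  have hpos : ∀ τ ∈ Set.Ioi (0 : ℝ), 0 < rexp (-τ ^ 3 / 3 + 0 * τ) * τ ^ s :=
    fun τ hτ => mul_pos (exp_pos _) (rpow_pos_of_pos hτ _)
  refine ⟨_, ?_, by simpa using cubicLaplace_ofReal s 0⟩
  have := (setIntegral_pos_iff_support_of_nonneg_ae (μ := volume) ((ae_restrict_mem
    measurableSet_Ioi).mono fun τ hτ => (hpos τ hτ).le) hint).2 (by
      rw [Set.inter_eq_right.2 fun τ hτ => Function.mem_support.2 (hpos τ hτ).ne']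
      simp)
  simpa using this

lemma exp_pi_div_six_mul_I_pow_three : Complex.exp ((π / 6 : ℝ) * Complex.I) ^ 3 = Complex.I := by
  rw [← Complex.exp_nat_mul]
  refine Eq.trans ?_ Complex.exp_pi_div_two_mul_I
  congr 1
  push_cast
  ring

lemma norm_exp_cubic_arc_le {θ T y : ℝ} (hT : 0 < T) (hTθ : 2 * (1 + |θ|) ≤ T ^ 2)
    (hy : 0 ≤ y) (hy' : y ≤ π / 6) :
    ‖Complex.exp (Complex.I * ((T * Complex.exp (y * Complex.I)) ^ 3 / 3
      + θ * (T * Complex.exp (y * Complex.I))))‖ ≤ rexp (-T * y) := by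
  have h3 : Complex.exp (y * Complex.I) ^ 3 = Complex.exp ((3 * y : ℝ) * Complex.I) := by
    rw [← Complex.exp_nat_mul]
    congr 1
    push_cast
    ring
  have hre : (Complex.I * ((T * Complex.exp (y * Complex.I)) ^ 3 / 3
      + θ * (T * Complex.exp (y * Complex.I)))).re = -(T ^ 3 / 3 * sin (3 * y)) - θ * T * sin y := by
    have : Complex.I * ((T * Complex.exp (y * Complex.I)) ^ 3 / 3
      + θ * (T * Complex.exp (y * Complex.I))) =
        Complex.I * (((T ^ 3 / 3 : ℝ) : ℂ) * Complex.exp ((3 * y : ℝ) * Complex.I)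
          + ((θ * T : ℝ) : ℂ) * Complex.exp (y * Complex.I)) := by
      rw [mul_pow, h3]
      push_cast
      ring
    rw [this, Complex.I_mul_re, Complex.add_im, Complex.im_ofReal_mul, Complex.im_ofReal_mul,
      Complex.exp_ofReal_mul_I_im, Complex.exp_ofReal_mul_I_im]
    ring
  rw [Complex.norm_exp, hre, exp_le_exp]
  have hsin3 : 3 / 2 * y ≤ sin (3 * y) := by
    refine le_trans ?_ (mul_le_sin (by linarith) (by linarith))
    have : 1 / 2 ≤ 2 / π := by
      rw [div_le_div_iff₀ two_pos pi_pos]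
      linarith [pi_le_four]
    nlinarith
  have hsin : |sin y| ≤ y := by
    simpa [abs_of_nonneg hy] using abs_sin_le_abs (x := y)
  have h4 : -(θ * T * sin y) ≤ |θ| * T * y := by
    refine (neg_le_abs _).trans ?_
    rw [abs_mul, abs_mul, abs_of_pos hT]
    gcongr
  have h5 : T ^ 3 / 3 * (3 / 2 * y) ≤ T ^ 3 / 3 * sin (3 * y) := by gcongr
  nlinarith [mul_le_mul_of_nonneg_right hTθ (by positivity : 0 ≤ T * y)]

lemma integral_exp_neg_mul_le {T α : ℝ} (hT : 0 < T) :
    ∫ y in (0 : ℝ)..α, rexp (-T * y) ≤ T⁻¹ := by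
  have hne : -T ≠ 0 := by linarith
  rw [intervalIntegral.integral_comp_mul_left (fun x => rexp x) hne, integral_exp]
  simp only [mul_zero, exp_zero, smul_eq_mul]
  have := mul_pos (inv_pos.2 hT) (exp_pos (-T * α))
  rw [inv_neg]
  linarith

lemma tendsto_integral_exp_cubic {s : ℝ} (hs : -1 < s) (hs0 : s < 0) (θ : ℝ) :
    Tendsto (fun T : ℝ => ∫ τ in (0 : ℝ)..T,
      ((τ ^ s : ℝ) : ℂ) * Complex.exp (Complex.I * ((τ : ℂ) ^ 3 / 3 + θ * τ))) atTop
      (𝓝 (Complex.exp ((s + 1) * ((π / 6 : ℝ) * Complex.I)) *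
        cubicLaplace s (Complex.I * Complex.exp ((π / 6 : ℝ) * Complex.I) * θ))) := by
  set g : ℂ → ℂ := fun z => Complex.exp (Complex.I * (z ^ 3 / 3 + θ * z)) with hg
  have hgd : Differentiable ℂ g := by fun_prop
  have hgrot : ∀ τ : ℝ, g (τ * Complex.exp ((π / 6 : ℝ) * Complex.I)) =
      Complex.exp (-(τ : ℂ) ^ 3 / 3
        + Complex.I * Complex.exp ((π / 6 : ℝ) * Complex.I) * θ * τ) := by
    intro τ
    simp only [hg, mul_pow, exp_pi_div_six_mul_I_pow_three]
    congr 1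
    linear_combination (τ : ℂ) ^ 3 / 3 * Complex.I_mul_I
  have hray := intervalIntegral_tendsto_integral_Ioi (0 : ℝ) (integrableOn_cubicLaplace hs
    (Complex.I * Complex.exp ((π / 6 : ℝ) * Complex.I) * θ)) tendsto_id
  have harc : Tendsto (fun T : ℝ => ∫ y in (0 : ℝ)..π / 6, ((T ^ (s + 1) : ℝ) : ℂ)
      * (Complex.exp ((s + 1) * (y * Complex.I)) * g (T * Complex.exp (y * Complex.I))))
      atTop (𝓝 0) := by
    have hlim : Tendsto (fun T : ℝ => T ^ s) atTop (𝓝 0) := by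
      simpa using tendsto_rpow_neg_atTop (neg_pos.2 hs0)
    refine squeeze_zero_norm' ?_ hlim
    filter_upwards [eventually_gt_atTop (0 : ℝ),
      (tendsto_pow_atTop two_ne_zero).eventually_ge_atTop (2 * (1 + |θ|))] with T hT hTθ
    have hpi : (0 : ℝ) ≤ π / 6 := by positivity
    have hb := intervalIntegral.norm_integral_le_of_norm_le (μ := volume) hpi
      (f := fun y : ℝ => ((T ^ (s + 1) : ℝ) : ℂ)
      * (Complex.exp ((s + 1) * (y * Complex.I)) * g (T * Complex.exp (y * Complex.I))))
      (g := fun y => T ^ (s + 1) * rexp (-T * y)) (by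
        filter_upwards with y hy
        have h1 : ‖Complex.exp ((s + 1) * (y * Complex.I))‖ = 1 := by
          have := Complex.norm_exp_ofReal_mul_I ((s + 1) * y)
          push_cast at this
          rwa [mul_assoc] at this
        rw [norm_mul, norm_mul, h1, one_mul, Complex.norm_real,
          norm_of_nonneg (rpow_nonneg hT.le _)]
        exact mul_le_mul_of_nonneg_left (norm_exp_cubic_arc_le hT hTθ hy.1.le hy.2)
          (rpow_nonneg hT.le _))
      (Continuous.intervalIntegrable (by fun_prop) _ _)
    refine hb.trans ?_
    rw [intervalIntegral.integral_const_mul]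
    refine (mul_le_mul_of_nonneg_left (integral_exp_neg_mul_le hT)
      (rpow_nonneg hT.le _)).trans_eq ?_
    rw [rpow_add_one hT.ne', mul_inv_cancel_right₀ hT.ne']
  have hlim := (hray.const_mul (Complex.exp ((s + 1) * ((π / 6 : ℝ) * Complex.I)))).sub
    (harc.const_mul Complex.I)
  rw [mul_zero, sub_zero] at hlim
  refine hlim.congr' ?_
  filter_upwards [eventually_gt_atTop (0 : ℝ)] with T hT
  have := integral_rpow_mul_rotate hs hT hgd (π / 6)
  simp only [hgrot] at this
  simp only [id]
  linear_combination -this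

lemma tendsto_integral_cos_cubic {s : ℝ} (hs : -1 < s) (hs0 : s < 0) (θ φ : ℝ) :
    Tendsto (fun T : ℝ => ∫ τ in (0 : ℝ)..T, cos (τ ^ 3 / 3 + θ * τ + φ) * τ ^ s) atTop
      (𝓝 (Complex.exp (φ * Complex.I) * (Complex.exp ((s + 1) * ((π / 6 : ℝ) * Complex.I)) *
        cubicLaplace s (Complex.I * Complex.exp ((π / 6 : ℝ) * Complex.I) * θ))).re) := by
  have h := (Complex.continuous_re.tendsto _).comp
    ((tendsto_integral_exp_cubic hs hs0 θ).const_mul (Complex.exp (φ * Complex.I)))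
  refine h.congr fun T => ?_
  have hint : IntervalIntegrable (fun τ : ℝ => Complex.exp (φ * Complex.I) *
      (((τ ^ s : ℝ) : ℂ) * Complex.exp (Complex.I * ((τ : ℂ) ^ 3 / 3 + θ * τ)))) volume 0 T := by
    refine IntervalIntegrable.const_mul (IntervalIntegrable.mul_continuousOn
      ⟨(intervalIntegral.intervalIntegrable_rpow' hs).1.ofReal,
        (intervalIntegral.intervalIntegrable_rpow' hs).2.ofReal⟩ ?_) _
    exact Continuous.continuousOn (by fun_prop)
  simp only [Function.comp]
  rw [← intervalIntegral.integral_const_mul, ← Complex.reCLM_apply,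
    ← Complex.reCLM.intervalIntegral_comp_comm hint]
  refine intervalIntegral.integral_congr fun τ _ => ?_
  simp only [Complex.reCLM_apply]
  have : Complex.exp (φ * Complex.I) * (((τ ^ s : ℝ) : ℂ) *
      Complex.exp (Complex.I * ((τ : ℂ) ^ 3 / 3 + θ * τ))) =
      ((τ ^ s : ℝ) : ℂ) * Complex.exp ((τ ^ 3 / 3 + θ * τ + φ : ℝ) * Complex.I) := by
    rw [mul_left_comm, ← Complex.exp_add]
    congr 2
    push_cast
    ring
  rw [this, Complex.re_ofReal_mul, Complex.exp_ofReal_mul_I_re, mul_comm]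

lemma cubicLaplace_relation_succ {s : ℝ} (hs : -1 < s) {a ν ω : ℂ}
    (h : ∀ θ : ℝ, (a * cubicLaplace s θ + ν * cubicLaplace s (ω * θ)).re = 0) (θ : ℝ) :
    (a * cubicLaplace (s + 1) θ + ν * ω * cubicLaplace (s + 1) (ω * θ)).re = 0 := by
  have h1 := hasDerivAt_cubicLaplace hs (θ : ℂ)
  have h2 : HasDerivAt (fun z : ℂ => cubicLaplace s (ω * z))
      (cubicLaplace (s + 1) (ω * θ) * ω) (θ : ℂ) :=
    HasDerivAt.comp (θ : ℂ) (hasDerivAt_cubicLaplace hs (ω * θ))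
      (by simpa using (hasDerivAt_id (θ : ℂ)).const_mul ω)
  have h3 := ((h1.const_mul a).add (h2.const_mul ν)).real_of_complex
  have h4 : HasDerivAt (fun _ : ℝ => (0 : ℝ)) _ θ :=
    h3.congr_of_eventuallyEq (Eventually.of_forall fun x => (h x).symm)
  have h5 := h4.unique (hasDerivAt_const θ (0 : ℝ))
  rw [← h5]
  congr 1
  ring

lemma eq_zero_of_cubicLaplace_relation {s : ℝ} (hs : -1 < s) {a : ℝ} {ν : ℂ}
    (h : ∀ θ : ℝ, ((a : ℂ) * cubicLaplace s θ + ν * cubicLaplace s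
      (Complex.I * Complex.exp ((π / 6 : ℝ) * Complex.I) * θ)).re = 0) : a = 0 ∧ ν = 0 := by
  set ω : ℂ := Complex.I * Complex.exp ((π / 6 : ℝ) * Complex.I) with hω
  have hωre : ω.re = -(1 / 2) := by
    rw [hω, Complex.I_mul_re, Complex.exp_ofReal_mul_I_im, sin_pi_div_six]
  have hωim : ω.im = √3 / 2 := by
    rw [hω, Complex.I_mul_im, Complex.exp_ofReal_mul_I_re, cos_pi_div_six]
  have h' := cubicLaplace_relation_succ hs h
  have h'' := cubicLaplace_relation_succ (by linarith : -1 < s + 1) h'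
  have coeff : ∀ {t : ℝ} {μ : ℂ}, -1 < t →
      (∀ θ : ℝ, ((a : ℂ) * cubicLaplace t θ + μ * cubicLaplace t (ω * θ)).re = 0) →
      a + μ.re = 0 := by
    intro t μ ht hθ
    obtain ⟨r, hr, hr'⟩ := exists_cubicLaplace_zero_eq ht
    have h0 := hθ 0
    rw [Complex.ofReal_zero, mul_zero, hr', ← add_mul, Complex.re_mul_ofReal] at h0
    simpa [hr.ne'] using h0
  have e0 := coeff hs h
  have e1 := coeff (by linarith) h'
  have e2 := coeff (by linarith) h''
  simp only [Complex.mul_re, Complex.mul_im, hωre, hωim] at e1 e2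
  have h3 : √3 * √3 = 3 := mul_self_sqrt (by norm_num)
  have hs3 : √3 ≠ 0 := by positivity
  have e2' : a - 1 / 2 * ν.re + √3 / 2 * ν.im = 0 := by
    linear_combination e2 + ν.re / 4 * h3
  have ha : a = 0 := by linarith
  have hre : ν.re = 0 := by linarith
  have him : ν.im = 0 := by
    have : √3 * ν.im = 0 := by linarith
    exact (mul_eq_zero.1 this).resolve_left hs3
  exact ⟨ha, Complex.ext hre him⟩

end CubicLaplace

/-- For `ξ ∈ (0,1)`, the three functions `La_ξ`, `Lb_ξ`, `Lc_ξ`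
(the latter two characterized as the improper Riemann integral limits) are linearly
independent over `ℝ`: any real linear combination vanishing identically is trivial. -/
theorem La_Lb_Lc_linearly_independent (ξ : ℝ) (hξ : ξ ∈ Set.Ioo (0 : ℝ) 1)
    (La Lb Lc : ℝ → ℝ)
    (hLa : ∀ θ : ℝ, La θ = ∫ τ in Set.Ioi (0 : ℝ),
      Real.exp (-τ ^ 3 / 3 + θ * τ) * τ ^ (-ξ))
    (hLb : ∀ θ : ℝ, Tendsto
      (fun T : ℝ => ∫ τ in (0 : ℝ)..T,
        Real.cos (τ ^ 3 / 3 + θ * τ + ξ * π / 2) * τ ^ (-ξ))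
      atTop (nhds (Lb θ)))
    (hLc : ∀ θ : ℝ, Tendsto
      (fun T : ℝ => ∫ τ in (0 : ℝ)..T,
        Real.cos (τ ^ 3 / 3 + θ * τ - ξ * π / 2) * τ ^ (-ξ))
      atTop (nhds (Lc θ)))
    (a b c : ℝ) (h : ∀ θ : ℝ, a * La θ + b * Lb θ + c * Lc θ = 0) :
    a = 0 ∧ b = 0 ∧ c = 0 := by
  obtain ⟨hξ0, hξ1⟩ := hξ
  have hs : -1 < -ξ := by linarith
  have hs0 : -ξ < 0 := by linarith
  have hb := fun θ => tendsto_nhds_unique (hLb θ)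
    (tendsto_integral_cos_cubic hs hs0 θ (ξ * π / 2))
  have hc := fun θ => tendsto_nhds_unique (hLc θ) (by
    simpa only [← sub_eq_add_neg] using tendsto_integral_cos_cubic hs hs0 θ (-(ξ * π / 2)))
  set ρ : ℂ := Complex.exp ((((-ξ : ℝ) : ℂ) + 1) * ((π / 6 : ℝ) * Complex.I)) with hρ
  set κ : ℂ := b * Complex.exp ((ξ * π / 2 : ℝ) * Complex.I)
    + c * Complex.exp ((-(ξ * π / 2) : ℝ) * Complex.I) with hκ
  obtain ⟨ha, hν⟩ := eq_zero_of_cubicLaplace_relation hs (a := a) (ν := κ * ρ) fun θ => by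
    rw [← h θ, hb, hc, hLa, cubicLaplace_ofReal, Complex.add_re, ← Complex.ofReal_mul,
      Complex.ofReal_re, add_assoc, ← Complex.re_ofReal_mul, ← Complex.re_ofReal_mul,
      ← Complex.add_re]
    congr 2
    rw [hκ]
    ring
  have hκ0 : κ = 0 := (mul_eq_zero.1 hν).resolve_right (Complex.exp_ne_zero _)
  have hre := congrArg Complex.re hκ0
  have him := congrArg Complex.im hκ0
  rw [hκ, Complex.add_re, Complex.re_ofReal_mul, Complex.re_ofReal_mul,
    Complex.exp_ofReal_mul_I_re, Complex.exp_ofReal_mul_I_re, cos_neg, Complex.zero_re,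
    ← add_mul] at hre
  rw [hκ, Complex.add_im, Complex.im_ofReal_mul, Complex.im_ofReal_mul,
    Complex.exp_ofReal_mul_I_im, Complex.exp_ofReal_mul_I_im, sin_neg, Complex.zero_im,
    mul_neg, ← sub_eq_add_neg, ← sub_mul] at him
  have hpos : 0 < ξ * π / 2 := by positivity
  have hlt : ξ * π / 2 < π / 2 := by nlinarith [pi_pos]
  have hadd := (mul_eq_zero.1 hre).resolve_right
    (cos_pos_of_mem_Ioo ⟨by linarith, hlt⟩).ne'
  have hsub := (mul_eq_zero.1 him).resolve_right
    (sin_pos_of_pos_of_lt_pi hpos (by linarith)).ne'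
  exact ⟨ha, by linarith, by linarith⟩
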